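/- arXiv:2005.14437 — 10 statements merged into one kernel-verified Lean document; each statement's English description precedes it below -/
import Mathlib

section
/- Let y = (q,p,θ) : [0,T] → ℝ × ℝ × (0,∞) be absolutely continuous. Then y solves the damped harmonic oscillator system q' = p/m, p' = −νp/m − κq − λθ, θ' = νp²/(m²c) + λpθ/(mc) almost everywhere in [0,T] if and only if the following three conditions hold: q' = p/m a.e., p p' + κ p q + m c θ' = 0 a.e., and for every t ∈ [0,T] the energy-dissipation inequality −S(y(t)) + ∫₀ᵗ [ (p'(s) + κq(s) + λθ(s))² / (2νθ(s)) + ν p(s)² / (2 m² θ(s)) ] ds + S(y(0)) ≤ 0 is satisfied. -/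
open MeasureTheory

/-- Post-composition with a Lipschitz function preserves absolute continuity. -/
theorem LipschitzOnWith.comp_absolutelyContinuousOnInterval {X Y : Type*} [PseudoMetricSpace X]
    [PseudoMetricSpace Y] {g : X → Y} {f : ℝ → X} {K : NNReal} {s : Set X} {a b : ℝ}
    (hg : LipschitzOnWith K g s) (hf : AbsolutelyContinuousOnInterval f a b)
    (hs : Set.MapsTo f (Set.uIcc a b) s) :
    AbsolutelyContinuousOnInterval (fun x => g (f x)) a b := by
  rw [absolutelyContinuousOnInterval_iff] at hf ⊢
  intro ε hε
  obtain ⟨δ, hδ, h⟩ := hf (ε / (K + 1)) (by positivity)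
  refine ⟨δ, hδ, fun E hE hE' => ?_⟩
  have hlt := h E hE hE'
  calc ∑ i ∈ Finset.range E.1, dist (g (f (E.2 i).1)) (g (f (E.2 i).2))
      ≤ ∑ i ∈ Finset.range E.1, K * dist (f (E.2 i).1) (f (E.2 i).2) :=
        Finset.sum_le_sum fun i hi =>
          hg.dist_le_mul _ (hs (hE.left i hi).left) _ (hs (hE.left i hi).right)
    _ = K * ∑ i ∈ Finset.range E.1, dist (f (E.2 i).1) (f (E.2 i).2) :=
        (Finset.mul_sum _ _ _).symm
    _ ≤ K * (ε / (K + 1)) := by gcongr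
    _ < (K + 1) * (ε / (K + 1)) := by gcongr; linarith
    _ = ε := by field

/-- A positive primitive of an integrable function satisfies the fundamental theorem of calculus
for its logarithmic derivative. -/
theorem integral_logDeriv_eq_sub_of_primitive {f f' : ℝ → ℝ} {a b : ℝ} (hab : a ≤ b)
    (hpos : ∀ t ∈ Set.Icc a b, 0 < f t) (hint : IntervalIntegrable f' volume a b)
    (hFTC : ∀ t ∈ Set.Icc a b, f t = f a + ∫ s in a..t, f' s) :
    ∫ s in a..b, f' s / f s = Real.log (f b) - Real.log (f a) := by
  have hu : Set.uIcc a b = Set.Icc a b := Set.uIcc_of_le hab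
  let g : ℝ → ℝ := fun t => (∫ s in a..t, f' s) + f a
  have hgf : ∀ t ∈ Set.Icc a b, g t = f t := fun t ht => by
    simp only [g]; rw [hFTC t ht, add_comm]
  have hconst : AbsolutelyContinuousOnInterval (fun _ : ℝ => f a) a b :=
    (contDiffOn_const (𝕜 := ℝ)).absolutelyContinuousOnInterval
  have hgac : AbsolutelyContinuousOnInterval g a b :=
    (hint.absolutelyContinuousOnInterval_intervalIntegral (c := a) Set.left_mem_uIcc).add hconst
  have hgcont : ContinuousOn g (Set.Icc a b) := hu ▸ hgac.continuousOn
  obtain ⟨x₀, hx₀, hmin⟩ := isCompact_Icc.exists_isMinOn (Set.nonempty_Icc.2 hab) hgcont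
  obtain ⟨x₁, -, hmax⟩ := isCompact_Icc.exists_isMaxOn (Set.nonempty_Icc.2 hab) hgcont
  have hδ : 0 < g x₀ := by rw [hgf x₀ hx₀]; exact hpos x₀ hx₀
  have hlog : ContDiffOn ℝ 1 Real.log (Set.Icc (g x₀) (g x₁)) := fun x hx =>
    (Real.contDiffAt_log.2 (hδ.trans_le hx.1).ne').contDiffWithinAt
  obtain ⟨K, hK⟩ := hlog.exists_lipschitzOnWith (by decide) (convex_Icc _ _) isCompact_Icc
  have hac : AbsolutelyContinuousOnInterval (fun x => Real.log (g x)) a b :=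
    hK.comp_absolutelyContinuousOnInterval hgac fun x hx => by
      rw [hu] at hx
      exact ⟨hmin hx, hmax hx⟩
  rw [← hgf b ⟨hab, le_rfl⟩, ← hgf a ⟨le_rfl, hab⟩, ← hac.integral_deriv_eq_sub]
  refine intervalIntegral.integral_congr_ae ?_
  filter_upwards [hint.ae_hasDerivAt_integral] with x hx hxab
  have hxu : x ∈ Set.uIcc a b := Set.uIoc_subset_uIcc hxab
  have hxI : x ∈ Set.Icc a b := hu ▸ hxu
  have hd : HasDerivAt g (f' x) x := (hx hxu a Set.left_mem_uIcc).add_const _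
  have hne : g x ≠ 0 := by rw [hgf x hxI]; exact (hpos x hxI).ne'
  rw [(hd.log hne).deriv, hgf x hxI]

/-- A primitive of an integrable function is continuous. -/
theorem continuousOn_Icc_of_primitive {f f' : ℝ → ℝ} {a b : ℝ} (hab : a ≤ b)
    (hint : IntervalIntegrable f' volume a b)
    (hFTC : ∀ t ∈ Set.Icc a b, f t = f a + ∫ s in a..t, f' s) :
    ContinuousOn f (Set.Icc a b) := by
  have h := (hint.absolutelyContinuousOnInterval_intervalIntegral
    (c := a) Set.left_mem_uIcc).continuousOn
  rw [Set.uIcc_of_le hab] at h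
  exact (continuousOn_const.add h).congr hFTC

/-- **De Giorgi energy-dissipation principle for the damped harmonic oscillator.**
Let `y = (q,p,θ) : [0,T] → ℝ×ℝ×(0,∞)` be absolutely continuous (encoded by
integrable a.e. derivatives `q',p',θ'` together with the fundamental theorem of
calculus). Then `y` solves `q' = p/m`, `p' = −νp/m − κq − λθ`,
`θ' = νp²/(m²c) + λpθ/(mc)` a.e. in `[0,T]` if and only if `q' = p/m` a.e.,
`p p' + κ p q + m c θ' = 0` a.e., and for every `t ∈ [0,T]` the energy-dissipation
inequality
`−S(y(t)) + ∫₀ᵗ [(p'+κq+λθ)²/(2νθ) + νp²/(2m²θ)] + S(y(0)) ≤ 0` holds,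
where `S(q,p,θ) = −λq + c + c log θ`. -/
theorem stmt1 (m ν κ lam c T : ℝ) (hm : 0 < m) (hν : 0 < ν) (hκ : 0 < κ)
    (hlam : 0 < lam) (hc : 0 < c) (hT : 0 < T)
    (q p θ q' p' θ' : ℝ → ℝ)
    (hθpos : ∀ t ∈ Set.Icc (0 : ℝ) T, 0 < θ t)
    (hq'int : IntervalIntegrable q' volume 0 T)
    (hp'int : IntervalIntegrable p' volume 0 T)
    (hθ'int : IntervalIntegrable θ' volume 0 T)
    (hqFTC : ∀ t ∈ Set.Icc (0 : ℝ) T, q t = q 0 + ∫ s in (0 : ℝ)..t, q' s)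
    (hpFTC : ∀ t ∈ Set.Icc (0 : ℝ) T, p t = p 0 + ∫ s in (0 : ℝ)..t, p' s)
    (hθFTC : ∀ t ∈ Set.Icc (0 : ℝ) T, θ t = θ 0 + ∫ s in (0 : ℝ)..t, θ' s) :
    (∀ᵐ t ∂(volume.restrict (Set.Ioc (0 : ℝ) T)),
        q' t = p t / m ∧
        p' t = -ν * p t / m - κ * q t - lam * θ t ∧
        θ' t = ν * p t ^ 2 / (m ^ 2 * c) + lam * p t * θ t / (m * c)) ↔
    ((∀ᵐ t ∂(volume.restrict (Set.Ioc (0 : ℝ) T)), q' t = p t / m) ∧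
     (∀ᵐ t ∂(volume.restrict (Set.Ioc (0 : ℝ) T)),
        p t * p' t + κ * p t * q t + m * c * θ' t = 0) ∧
     (∀ t ∈ Set.Icc (0 : ℝ) T,
        (∫⁻ s in Set.Ioc (0 : ℝ) t,
            ENNReal.ofReal ((p' s + κ * q s + lam * θ s) ^ 2 / (2 * ν * θ s)
              + ν * p s ^ 2 / (2 * m ^ 2 * θ s)))
          ≤ ENNReal.ofReal ((-lam * q t + c + c * Real.log (θ t))
              - (-lam * q 0 + c + c * Real.log (θ 0))))) := by
  have hqc := continuousOn_Icc_of_primitive hT.le hq'int hqFTC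
  have hpc := continuousOn_Icc_of_primitive hT.le hp'int hpFTC
  have hθc := continuousOn_Icc_of_primitive hT.le hθ'int hθFTC
  set F : ℝ → ℝ := fun s => (p' s + κ * q s + lam * θ s) ^ 2 / (2 * ν * θ s)
    + ν * p s ^ 2 / (2 * m ^ 2 * θ s) with hF
  let σ : ℝ → ℝ := fun s => -lam * q' s + c * (θ' s / θ s)
  have hσint : IntervalIntegrable σ volume 0 T := by
    refine (hq'int.const_mul _).add (IntervalIntegrable.const_mul ?_ _)
    simp only [div_eq_mul_inv]
    refine hθ'int.mul_continuousOn ?_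
    rw [Set.uIcc_of_le hT.le]
    exact hθc.inv₀ fun t ht => (hθpos t ht).ne'
  have hσ : ∀ t ∈ Set.Icc (0 : ℝ) T, (-lam * q t + c + c * Real.log (θ t))
      - (-lam * q 0 + c + c * Real.log (θ 0)) = ∫ s in Set.Ioc (0 : ℝ) t, σ s := by
    intro t ht
    have hsub : Set.uIcc 0 t ⊆ Set.uIcc 0 T := by
      rw [Set.uIcc_of_le ht.1, Set.uIcc_of_le hT.le]
      exact Set.Icc_subset_Icc_right ht.2
    have hsub' : Set.Icc 0 t ⊆ Set.Icc 0 T := Set.Icc_subset_Icc_right ht.2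
    have hdiv : IntervalIntegrable (fun s => θ' s / θ s) volume 0 t := by
      simp only [div_eq_mul_inv]
      refine (hθ'int.mono_set hsub).mul_continuousOn ?_
      rw [Set.uIcc_of_le ht.1]
      exact (hθc.mono hsub').inv₀ fun s hs => (hθpos s (hsub' hs)).ne'
    have hlog := integral_logDeriv_eq_sub_of_primitive ht.1 (fun s hs => hθpos s (hsub' hs))
      (hθ'int.mono_set hsub) (fun s hs => hθFTC s (hsub' hs))
    rw [← intervalIntegral.integral_of_le ht.1,
      intervalIntegral.integral_add ((hq'int.mono_set hsub).const_mul _) (hdiv.const_mul _),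
      intervalIntegral.integral_const_mul, intervalIntegral.integral_const_mul, hlog, hqFTC t ht]
    ring
  have hFnn : ∀ t ∈ Set.Icc (0 : ℝ) T, 0 ≤ F t := fun t ht => by
    have := hθpos t ht
    simp only [hF]
    positivity
  have hIoc : ∀ᵐ t ∂(volume.restrict (Set.Ioc (0 : ℝ) T)), t ∈ Set.Ioc (0 : ℝ) T :=
    ae_restrict_mem measurableSet_Ioc
  have hFσ : ∀ t ∈ Set.Icc (0 : ℝ) T, q' t = p t / m →
      p t * p' t + κ * p t * q t + m * c * θ' t = 0 →
      F t - σ t = (p' t + κ * q t + lam * θ t + ν * p t / m) ^ 2 / (2 * ν * θ t) := by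
    intro t ht h1 h2
    have hpos := hθpos t ht
    have h3 : θ' t = -(p t * p' t + κ * p t * q t) / (m * c) := by
      field_simp
      linarith
    simp only [hF, σ, h1, h3]
    field_simp
    ring
  constructor
  · intro h
    have h2 : ∀ᵐ t ∂(volume.restrict (Set.Ioc (0 : ℝ) T)),
        p t * p' t + κ * p t * q t + m * c * θ' t = 0 := by
      filter_upwards [h] with t ht
      rw [ht.2.1, ht.2.2]
      field_simp
      ring
    refine ⟨h.mono fun t ht => ht.1, h2, fun t ht => ?_⟩
    have hFeq : ∀ᵐ s ∂(volume.restrict (Set.Ioc (0 : ℝ) T)), F s = σ s ∧ 0 ≤ σ s := by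
      filter_upwards [h, h2, hIoc] with s hs hs2 hsI
      have hsI := Set.Ioc_subset_Icc_self hsI
      have h3 := hFσ s hsI hs.1 hs2
      have h4 : p' s + κ * q s + lam * θ s + ν * p s / m = 0 := by
        rw [hs.2.1]
        ring
      rw [h4, zero_pow two_ne_zero, zero_div] at h3
      have h5 : F s = σ s := by linarith
      exact ⟨h5, h5 ▸ hFnn s hsI⟩
    have hFeq := ae_restrict_of_ae_restrict_of_subset (Set.Ioc_subset_Ioc_right ht.2) hFeq
    have hσt : IntegrableOn σ (Set.Ioc 0 t) :=
      ((intervalIntegrable_iff_integrableOn_Ioc_of_le hT.le).1 hσint).mono_set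
        (Set.Ioc_subset_Ioc_right ht.2)
    rw [hσ t ht, ofReal_integral_eq_lintegral_ofReal hσt (hFeq.mono fun s hs => hs.2)]
    exact (lintegral_congr_ae (hFeq.mono fun s hs => by
      change ENNReal.ofReal (F s) = _
      rw [hs.1])).le
  · rintro ⟨h1, h2, h3⟩
    have hTm : T ∈ Set.Icc (0 : ℝ) T := ⟨hT.le, le_rfl⟩
    have hD := h3 T hTm
    rw [hσ T hTm] at hD
    have hσi : IntegrableOn σ (Set.Ioc 0 T) :=
      (intervalIntegrable_iff_integrableOn_Ioc_of_le hT.le).1 hσint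
    have meas : ∀ {f : ℝ → ℝ}, ContinuousOn f (Set.Icc 0 T) →
        AEMeasurable f (volume.restrict (Set.Ioc 0 T)) := fun hf =>
      (hf.mono Set.Ioc_subset_Icc_self).aemeasurable measurableSet_Ioc
    have hp'm : AEMeasurable p' (volume.restrict (Set.Ioc 0 T)) :=
      ((intervalIntegrable_iff_integrableOn_Ioc_of_le hT.le).1 hp'int).aemeasurable
    have hFm : AEMeasurable F (volume.restrict (Set.Ioc 0 T)) :=
      ((((hp'm.add ((meas hqc).const_mul κ)).add ((meas hθc).const_mul lam)).pow_const 2).div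
        ((meas hθc).const_mul (2 * ν))).add
      ((((meas hpc).pow_const 2).const_mul ν).div ((meas hθc).const_mul (2 * m ^ 2)))
    have hFnn' : 0 ≤ᵐ[volume.restrict (Set.Ioc 0 T)] F :=
      hIoc.mono fun t ht => hFnn t (Set.Ioc_subset_Icc_self ht)
    have hFi : IntegrableOn F (Set.Ioc 0 T) :=
      ⟨hFm.aestronglyMeasurable,
        (hasFiniteIntegral_iff_ofReal hFnn').2 (hD.trans_lt ENNReal.ofReal_lt_top)⟩
    rw [← ofReal_integral_eq_lintegral_ofReal hFi hFnn'] at hD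
    have hp' : ∀ᵐ t ∂(volume.restrict (Set.Ioc (0 : ℝ) T)),
        p' t + κ * q t + lam * θ t + ν * p t / m = 0 := by
      rcases le_total 0 (∫ s in Set.Ioc (0 : ℝ) T, σ s) with hs | hs
      · have hle := (ENNReal.ofReal_le_ofReal_iff hs).1 hD
        have hnn : 0 ≤ᵐ[volume.restrict (Set.Ioc 0 T)] fun t => F t - σ t := by
          filter_upwards [h1, h2, hIoc] with t ht1 ht2 htI
          have htI := Set.Ioc_subset_Icc_self htI
          have := hθpos t htI
          rw [Pi.zero_apply, hFσ t htI ht1 ht2]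
          positivity
        have h0 : ∫ t in Set.Ioc (0 : ℝ) T, (F t - σ t) = 0 := by
          refine le_antisymm ?_ (integral_nonneg_of_ae hnn)
          rw [integral_sub hFi hσi]
          linarith
        filter_upwards [(integral_eq_zero_iff_of_nonneg_ae hnn (hFi.sub hσi)).1 h0, h1, h2, hIoc]
          with t ht ht1 ht2 htI
        have htI := Set.Ioc_subset_Icc_self htI
        have hpos := hθpos t htI
        rw [hFσ t htI ht1 ht2, Pi.zero_apply, div_eq_zero_iff] at ht
        exact pow_eq_zero_iff two_ne_zero |>.1 (ht.resolve_right (by positivity))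
      · rw [ENNReal.ofReal_of_nonpos hs, nonpos_iff_eq_zero, ENNReal.ofReal_eq_zero] at hD
        have h0 := le_antisymm hD (integral_nonneg_of_ae hFnn')
        filter_upwards [(integral_eq_zero_iff_of_nonneg_ae hFnn' hFi).1 h0, hIoc] with t ht htI
        have hpos := hθpos t (Set.Ioc_subset_Icc_self htI)
        simp only [hF, Pi.zero_apply] at ht
        rw [add_eq_zero_iff_of_nonneg (by positivity) (by positivity), div_eq_zero_iff,
          div_eq_zero_iff] at ht
        have hA := pow_eq_zero_iff two_ne_zero |>.1 (ht.1.resolve_right (by positivity))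
        have hB := ht.2.resolve_right (by positivity)
        have hp0 : p t = 0 := by simpa [hν.ne'] using hB
        rw [hA, hp0]
        simp
    filter_upwards [h1, h2, hp'] with t ht1 ht2 ht3
    have h4 : p' t = -ν * p t / m - κ * q t - lam * θ t := by
      rw [neg_mul, neg_div]
      linarith
    refine ⟨ht1, h4, ?_⟩
    rw [h4] at ht2
    field_simp at ht2 ⊢
    linarith
end

section
/- For every y ∈ ℝ × ℝ × (0,∞) the matrix L(y) is antisymmetric, and the associated Poisson bracket {g,g̃}(y) = ∇g(y) · L(y)∇g̃(y) satisfies the Jacobi identity: for all twice continuously differentiable functions g₁, g₂, g₃ : ℝ × ℝ × (0,∞) → ℝ and all y ∈ ℝ × ℝ × (0,∞), {{g₁,g₂},g₃}(y) + {{g₂,g₃},g₁}(y) + {{g₃,g₁},g₂}(y) = 0. -/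
open Matrix

/-- The gradient of a function on `ℝ³`, via partial derivatives. -/
noncomputable def grad3 (g : (Fin 3 → ℝ) → ℝ) (y : Fin 3 → ℝ) : Fin 3 → ℝ :=
  fun i => fderiv ℝ g y (Pi.single i 1)

/-- The Poisson matrix of the damped harmonic oscillator, at state `y = (q,p,θ)`. -/
noncomputable def Lmat (lam c : ℝ) (y : Fin 3 → ℝ) : Matrix (Fin 3) (Fin 3) ℝ :=
  !![0, 1, 0; -1, 0, -lam * y 2 / c; 0, lam * y 2 / c, 0]

/-- The Poisson bracket `{g,g̃}(y) = ∇g(y) · L(y)∇g̃(y)`. -/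
noncomputable def pbr (lam c : ℝ) (g1 g2 : (Fin 3 → ℝ) → ℝ) (y : Fin 3 → ℝ) : ℝ :=
  grad3 g1 y ⬝ᵥ (Lmat lam c y).mulVec (grad3 g2 y)

lemma pbr_eq (lam c : ℝ) (f g : (Fin 3 → ℝ) → ℝ) (y : Fin 3 → ℝ) :
    pbr lam c f g y = grad3 f y 0 * grad3 g y 1 - grad3 f y 1 * grad3 g y 0
      + lam / c * (y 2 * (grad3 f y 2 * grad3 g y 1 - grad3 f y 1 * grad3 g y 2)) := by
  simp [pbr, Lmat, dotProduct, Matrix.mulVec, Fin.sum_univ_three]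
  ring

/-- The second partial derivative `∂ᵢ∂ⱼ g`, as an entry of the second Fréchet derivative. -/
noncomputable def hess3 (g : (Fin 3 → ℝ) → ℝ) (y : Fin 3 → ℝ) (i j : Fin 3) : ℝ :=
  fderiv ℝ (fderiv ℝ g) y (Pi.single i 1) (Pi.single j 1)

lemma hess3_comm {g : (Fin 3 → ℝ) → ℝ} {y : Fin 3 → ℝ} (hg : ContDiffAt ℝ 2 g y)
    (i j : Fin 3) : hess3 g y i j = hess3 g y j i :=
  (hg.isSymmSndFDerivAt (by simp)).eq _ _

lemma hasFDerivAt_grad3 {g : (Fin 3 → ℝ) → ℝ} {y : Fin 3 → ℝ} (hg : ContDiffAt ℝ 2 g y)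
    (j : Fin 3) :
    HasFDerivAt (fun z => grad3 g z j) ((fderiv ℝ (fderiv ℝ g) y).flip (Pi.single j 1)) y := by
  have h : DifferentiableAt ℝ (fderiv ℝ g) y :=
    (hg.fderiv_right (m := 1) (by norm_num)).differentiableAt (by norm_num)
  exact ((ContinuousLinearMap.apply ℝ ℝ (Pi.single j 1 : Fin 3 → ℝ)).hasFDerivAt).comp y
    h.hasFDerivAt

lemma grad3_pbr (lam c : ℝ) {f g : (Fin 3 → ℝ) → ℝ} {y : Fin 3 → ℝ}
    (hf : ContDiffAt ℝ 2 f y) (hg : ContDiffAt ℝ 2 g y) (i : Fin 3) :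
    grad3 (pbr lam c f g) y i =
      hess3 f y i 0 * grad3 g y 1 + grad3 f y 0 * hess3 g y i 1
      - (hess3 f y i 1 * grad3 g y 0 + grad3 f y 1 * hess3 g y i 0)
      + lam / c * ((Pi.single i 1 : Fin 3 → ℝ) 2
            * (grad3 f y 2 * grad3 g y 1 - grad3 f y 1 * grad3 g y 2)
          + y 2 * (hess3 f y i 2 * grad3 g y 1 + grad3 f y 2 * hess3 g y i 1
            - (hess3 f y i 1 * grad3 g y 2 + grad3 f y 1 * hess3 g y i 2))) := by
  have F := hasFDerivAt_grad3 hf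
  have G := hasFDerivAt_grad3 hg
  have hy : HasFDerivAt (fun z : Fin 3 → ℝ => z 2)
      (ContinuousLinearMap.proj 2 : (Fin 3 → ℝ) →L[ℝ] ℝ) y :=
    (ContinuousLinearMap.proj 2 : (Fin 3 → ℝ) →L[ℝ] ℝ).hasFDerivAt
  have key := (((F 0).mul (G 1)).sub ((F 1).mul (G 0))).add
    ((hy.mul (((F 2).mul (G 1)).sub ((F 1).mul (G 2)))).const_mul (lam / c))
  have key' : HasFDerivAt (pbr lam c f g) _ y :=
    key.congr_of_eventuallyEq (Filter.Eventually.of_forall fun z => pbr_eq lam c f g z)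
  rw [grad3, key'.fderiv]
  simp [hess3]
  ring

/-- **Antisymmetry and Jacobi identity for the oscillator's Poisson structure.**
For every state `y = (q,p,θ)` with `θ > 0`, the matrix `L(y)` is antisymmetric, and
for all `C²` functions `g₁,g₂,g₃` on `{θ > 0}` the Poisson bracket satisfies
`{{g₁,g₂},g₃} + {{g₂,g₃},g₁} + {{g₃,g₁},g₂} = 0` on `{θ > 0}`. -/
theorem stmt3 (m ν κ lam c : ℝ) (hm : 0 < m) (hν : 0 < ν) (hκ : 0 < κ)
    (hlam : 0 < lam) (hc : 0 < c) :
    (∀ y : Fin 3 → ℝ, 0 < y 2 → (Lmat lam c y)ᵀ = -Lmat lam c y) ∧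
    (∀ g1 g2 g3 : (Fin 3 → ℝ) → ℝ,
      ContDiffOn ℝ 2 g1 {y | 0 < y 2} →
      ContDiffOn ℝ 2 g2 {y | 0 < y 2} →
      ContDiffOn ℝ 2 g3 {y | 0 < y 2} →
      ∀ y : Fin 3 → ℝ, 0 < y 2 →
        pbr lam c (pbr lam c g1 g2) g3 y + pbr lam c (pbr lam c g2 g3) g1 y
          + pbr lam c (pbr lam c g3 g1) g2 y = 0) := by
  refine ⟨fun y _ => ?_, fun g1 g2 g3 h1 h2 h3 y hy => ?_⟩
  · ext i j
    fin_cases i <;> fin_cases j <;> simp [Lmat, neg_div]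
  · have hU : {y : Fin 3 → ℝ | 0 < y 2} ∈ nhds y :=
      (isOpen_lt continuous_const (continuous_apply 2)).mem_nhds hy
    have c1 := h1.contDiffAt hU
    have c2 := h2.contDiffAt hU
    have c3 := h3.contDiffAt hU
    simp only [pbr_eq lam c (pbr lam c _ _), grad3_pbr lam c c1 c2, grad3_pbr lam c c2 c3,
      grad3_pbr lam c c3 c1]
    simp only [hess3_comm c1 1 0, hess3_comm c1 2 0, hess3_comm c1 2 1,
      hess3_comm c2 1 0, hess3_comm c2 2 0, hess3_comm c2 2 1,
      hess3_comm c3 1 0, hess3_comm c3 2 0, hess3_comm c3 2 1]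
    simp
    ring
end

section
/- Let y = (q,p,θ) : [0,T] → ℝ × ℝ × (0,∞) be continuously differentiable and solve q' = p/m, p' = −νp/m − κq − λθ, θ' = νp²/(m²c) + λpθ/(mc) on [0,T]. Then the total energy is conserved, (d/dt) E(y(t)) = 0 for all t ∈ [0,T], and the total entropy is nondecreasing with explicit entropy rate (d/dt) S(y(t)) = ν p(t)² / (m² θ(t)) ≥ 0 for all t ∈ [0,T]. -/
/-- **Energy conservation and entropy production for the damped harmonic
oscillator.** If `(q,p,θ)` is continuously differentiable on `[0,T]`, has positive
temperature, and solves `q' = p/m`, `p' = −νp/m − κq − λθ`,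
`θ' = νp²/(m²c) + λpθ/(mc)`, then the total energy
`E = p²/(2m) + cθ + κq²/2` has zero derivative and the total entropy
`S = −λq + c + c log θ` has derivative `νp²/(m²θ) ≥ 0` at every `t ∈ [0,T]`. -/
theorem stmt5 (m ν κ lam c T : ℝ) (hm : 0 < m) (hν : 0 < ν) (hκ : 0 < κ)
    (hlam : 0 < lam) (hc : 0 < c) (hT : 0 < T) (q p θ : ℝ → ℝ)
    (hθpos : ∀ t ∈ Set.Icc (0 : ℝ) T, 0 < θ t)
    (hq : ∀ t ∈ Set.Icc (0 : ℝ) T, HasDerivAt q (p t / m) t)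
    (hp : ∀ t ∈ Set.Icc (0 : ℝ) T,
      HasDerivAt p (-ν * p t / m - κ * q t - lam * θ t) t)
    (hθ : ∀ t ∈ Set.Icc (0 : ℝ) T,
      HasDerivAt θ (ν * p t ^ 2 / (m ^ 2 * c) + lam * p t * θ t / (m * c)) t) :
    ∀ t ∈ Set.Icc (0 : ℝ) T,
      HasDerivAt (fun s => p s ^ 2 / (2 * m) + c * θ s + κ * q s ^ 2 / 2) 0 t ∧
      HasDerivAt (fun s => -lam * q s + c + c * Real.log (θ s))
        (ν * p t ^ 2 / (m ^ 2 * θ t)) t ∧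
      0 ≤ ν * p t ^ 2 / (m ^ 2 * θ t) := by
  intro t ht
  have hpos := hθpos t ht
  refine ⟨?_, ?_, by positivity⟩
  · refine HasDerivAt.congr_deriv (((((hp t ht).pow 2).div_const (2 * m)).add
      ((hθ t ht).const_mul c)).add ((((hq t ht).pow 2).const_mul κ).div_const 2)) ?_
    push_cast
    field_simp
    ring
  · refine HasDerivAt.congr_deriv ((((hq t ht).const_mul (-lam)).add_const c).add
      (((hθ t ht).log hpos.ne').const_mul c)) ?_
    field_simp
    ring
end

section
/- For every τ > 0 and every η = (q₀, p₀, θ₀) ∈ ℝ × ℝ × (0,∞), the incremental minimization problem admits a solution: there exists (q, p, θ) ∈ ℝ × ℝ × (0,∞) with θ > 0, (q − q₀)/τ = p/m, and c(θ − θ₀)/τ = −(p/m)(p − p₀)/τ − κ p q / m, minimizing G(τ,η;·) over all points satisfying these constraints; in particular G(τ,η;(q,p,θ)) = min_{y} G(τ,η;y) < ∞. -/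
/-- The incremental functional `G(τ,η;y)` of the minimizing-movements scheme for the
damped harmonic oscillator, with value `+∞` when the constraints fail. -/
noncomputable def Ginc (m ν κ lam c τ : ℝ) (η y : ℝ × ℝ × ℝ) : EReal :=
  if 0 < y.2.2 ∧ (y.1 - η.1) / τ = y.2.1 / m ∧
      c * (y.2.2 - η.2.2) / τ
        = -(y.2.1 / m) * ((y.2.1 - η.2.1) / τ) - κ * y.2.1 * y.1 / m then
    ((lam * y.1 - c * Real.log y.2.2
      + τ / (2 * ν * y.2.2) * ((y.2.1 - η.2.1) / τ + κ * y.1 + lam * y.2.2) ^ 2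
      + τ * ν / (2 * m) * y.2.1 ^ 2 / y.2.2
      - lam * η.1 + c * Real.log η.2.2 : ℝ) : EReal)
  else ⊤

/-- If `{0 ≤ T}` is bounded, then a function that is continuous on `{0 < T}` and has a continuous
minorant there, perturbed by the logarithmic barrier `-c log T`, attains its minimum on `{0 < T}`. -/
theorem exists_forall_log_barrier_le {c : ℝ} (hc : 0 < c) {T L h : ℝ → ℝ}
    (hT : Continuous T) (hL : Continuous L) (hh : ContinuousOn h {x | 0 < T x})
    (hb : Bornology.IsBounded {x | 0 ≤ T x}) (hLh : ∀ x, 0 < T x → L x ≤ h x)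
    {x₀ : ℝ} (hx₀ : 0 < T x₀) :
    ∃ x, 0 < T x ∧ ∀ z, 0 < T z → h x - c * Real.log (T x) ≤ h z - c * Real.log (T z) := by
  have hcomp : IsCompact {x | 0 ≤ T x} :=
    Metric.isCompact_of_isClosed_isBounded (isClosed_le continuous_const hT) hb
  obtain ⟨x₁, -, hx₁⟩ := hcomp.exists_isMinOn ⟨x₀, hx₀.le⟩ hL.continuousOn
  set A := h x₀ - c * Real.log (T x₀)
  set ε := min (T x₀) (Real.exp ((L x₁ - A) / c))
  have hε0 : 0 < ε := lt_min hx₀ (Real.exp_pos _)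
  have hK : IsCompact {x | ε ≤ T x} :=
    hcomp.of_isClosed_subset (isClosed_le continuous_const hT) fun x hx => hε0.le.trans hx
  have hpos : ∀ x ∈ {x | ε ≤ T x}, 0 < T x := fun x hx => hε0.trans_le hx
  have hcont : ContinuousOn (fun x => h x - c * Real.log (T x)) {x | ε ≤ T x} :=
    (hh.mono hpos).sub
      (continuousOn_const.mul (hT.continuousOn.log fun x hx => (hpos x hx).ne'))
  have hmem : x₀ ∈ {x | ε ≤ T x} := Set.mem_ofPred.2 (min_le_left _ _)
  obtain ⟨x, hx, hmin⟩ := hK.exists_isMinOn ⟨x₀, hmem⟩ hcont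
  refine ⟨x, hpos x hx, fun z hz => ?_⟩
  by_cases hzε : ε ≤ T z
  · exact hmin hzε
  · refine (show h x - c * Real.log (T x) ≤ A from hmin hmem).trans ?_
    have hlog : Real.log (T z) ≤ (L x₁ - A) / c :=
      (Real.log_le_iff_le_exp hz).2 ((not_le.1 hzε).le.trans (min_le_right _ _))
    rw [le_div_iff₀ hc] at hlog
    have hLz : L x₁ ≤ L z := hx₁ hz.le
    linarith [hLh z hz]

theorem isBounded_setOf_nonneg_concave_quadratic {a : ℝ} (ha : 0 < a) (b t : ℝ) :
    Bornology.IsBounded {p : ℝ | 0 ≤ t + b * p - a * p ^ 2} := by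
  refine (Metric.isBounded_closedBall (x := (0 : ℝ)) (r := (|b| + |t|) / a + 1)).subset ?_
  intro p hp
  rw [mem_closedBall_zero_iff, Real.norm_eq_abs]
  by_contra! hR
  have hp' : 0 ≤ t + b * p - a * p ^ 2 := hp
  have h1 : 1 ≤ |p| := by
    have : 0 ≤ (|b| + |t|) / a := by positivity
    linarith
  have h2 : |b| + |t| < a * (|p| - 1) := by
    rw [← div_lt_iff₀' ha]; linarith
  have h3 : b * p ≤ |b| * |p| := (le_abs_self _).trans (abs_mul b p).le
  have h4 : t ≤ |t| := le_abs_self t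
  have h5 : |t| ≤ |t| * |p| := le_mul_of_one_le_right (abs_nonneg _) h1
  rw [← sq_abs p] at hp'
  nlinarith

/-- **Existence of minimizers of the incremental problem.** For every `τ > 0` and
every `η = (q₀,p₀,θ₀)` with `θ₀ > 0`, there exists a point `(q,p,θ)` with `θ > 0`
satisfying the scheme constraints which minimizes `G(τ,η;·)`; in particular the
minimum is finite. -/
theorem stmt7 (m ν κ lam c : ℝ) (hm : 0 < m) (hν : 0 < ν) (hκ : 0 < κ)
    (hlam : 0 < lam) (hc : 0 < c) (τ : ℝ) (hτ : 0 < τ)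
    (η : ℝ × ℝ × ℝ) (hη : 0 < η.2.2) :
    ∃ y : ℝ × ℝ × ℝ, 0 < y.2.2 ∧
      (y.1 - η.1) / τ = y.2.1 / m ∧
      c * (y.2.2 - η.2.2) / τ
        = -(y.2.1 / m) * ((y.2.1 - η.2.1) / τ) - κ * y.2.1 * y.1 / m ∧
      (∀ z : ℝ × ℝ × ℝ, Ginc m ν κ lam c τ η y ≤ Ginc m ν κ lam c τ η z) ∧
      Ginc m ν κ lam c τ η y < ⊤ := by
  obtain ⟨q₀, p₀, θ₀⟩ := η
  dsimp only at hη ⊢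
  set a := (1 / m + τ ^ 2 * κ / m ^ 2) / c with ha
  set b := (p₀ / m - τ * κ * q₀ / m) / c with hb
  let Q : ℝ → ℝ := fun p => q₀ + τ * p / m
  let T : ℝ → ℝ := fun p => θ₀ + b * p - a * p ^ 2
  have ha0 : 0 < a := by positivity
  have hQ : ∀ q p, (q - q₀) / τ = p / m ↔ q = Q p := by
    intro q p
    rw [div_eq_div_iff hτ.ne' hm.ne', ← sub_eq_iff_eq_add', eq_div_iff hm.ne', mul_comm p τ]
  have hTiff : ∀ p θ, c * (θ - θ₀) / τ = -(p / m) * ((p - p₀) / τ) - κ * p * Q p / m ↔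
      θ = T p := by
    intro p θ
    have key : -(p / m) * ((p - p₀) / τ) - κ * p * Q p / m = c * (T p - θ₀) / τ := by
      simp only [Q, T, ha, hb]
      field_simp
      ring
    rw [key, div_left_inj' hτ.ne', mul_right_inj' hc.ne', sub_left_inj]
  let D : ℝ → ℝ := fun p => τ / (2 * ν * T p) * ((p - p₀) / τ + κ * Q p + lam * T p) ^ 2
    + τ * ν / (2 * m) * p ^ 2 / T p
  have hTc : Continuous T := by fun_prop
  have hQc : Continuous Q := by fun_prop
  have hDc : ContinuousOn D {p | 0 < T p} := by
    have hne : ∀ p ∈ {p | 0 < T p}, T p ≠ 0 := fun p hp => ne_of_gt hp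
    have hne' : ∀ p ∈ {p | 0 < T p}, 2 * ν * T p ≠ 0 := fun p hp =>
      mul_ne_zero (by positivity) (hne p hp)
    exact ((continuousOn_const.div (by fun_prop) hne').mul (by fun_prop)).add
      (ContinuousOn.div (by fun_prop) (by fun_prop) hne)
  have hD0 : ∀ p, 0 < T p → 0 ≤ D p := fun p hp => by
    simp only [D]
    positivity
  obtain ⟨p, hp, hmin⟩ := exists_forall_log_barrier_le hc hTc
    (L := fun p => lam * Q p) (h := fun p => lam * Q p + D p) (by fun_prop)
    (ContinuousOn.add (by fun_prop) hDc)
    (isBounded_setOf_nonneg_concave_quadratic ha0 b θ₀)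
    (fun p hp => le_add_of_nonneg_right (hD0 p hp)) (x₀ := 0) (by simpa [T] using hη)
  have hq := (hQ (Q p) p).2 rfl
  have hθ := (hTiff p (T p)).2 rfl
  refine ⟨(Q p, p, T p), hp, hq, hθ, ?_, ?_⟩
  · rintro ⟨q, r, θ⟩
    unfold Ginc
    dsimp only
    rw [if_pos ⟨hp, hq, hθ⟩]
    split_ifs with hz
    · obtain ⟨hz0, hz1, hz2⟩ := hz
      obtain rfl := (hQ _ _).1 hz1
      obtain rfl := (hTiff _ _).1 hz2
      rw [EReal.coe_le_coe_iff]
      have := hmin r hz0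
      simp only [D] at this
      linarith
    · exact le_top
  · unfold Ginc
    dsimp only
    rw [if_pos ⟨hp, hq, hθ⟩]
    exact EReal.coe_lt_top _
end

section
/- Assume the time step is small enough that max_{p∈ℝ} f(p) ≤ 2νc/(τλ²). Then F''(p) > 0 for every p with f(p) > 0, so F is strictly convex on the open interval {p : f(p) > 0}; consequently the problem of minimizing F over {p : f(p) > 0} has at most one solution, and the incremental minimization problem for G(τ,(q₀,p₀,θ₀);·) has a unique minimizer. -/
theorem hasDerivAt_quadratic (a A B x : ℝ) :
    HasDerivAt (fun p => A + B * p - a * p ^ 2) (B - 2 * a * x) x := by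
  have h := (((hasDerivAt_id' x).const_mul B).const_add A).sub
    (((hasDerivAt_id' x).pow 2).const_mul a)
  exact h.congr_deriv (by norm_num; ring)

theorem hasDerivAt_affine (s r x : ℝ) : HasDerivAt (fun p => s * p + r) s x :=
  (((hasDerivAt_id' x).const_mul s).add_const r).congr_deriv (by ring)

theorem hasDerivAt_affine_sq_div {f f' : ℝ → ℝ} {s r x : ℝ} (hf : HasDerivAt f (f' x) x)
    (h0 : f x ≠ 0) :
    HasDerivAt (fun p => (s * p + r) ^ 2 / f p)
      (2 * s * (s * x + r) / f x - (s * x + r) ^ 2 * f' x / f x ^ 2) x := by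
  refine (((hasDerivAt_affine s r x).pow 2).div hf h0).congr_deriv ?_
  simp only [Pi.pow_apply]
  field_simp
  norm_num
  ring

theorem hasDerivAt_deriv_affine_sq_div {f f' : ℝ → ℝ} {f2 s r x : ℝ}
    (hf : HasDerivAt f (f' x) x) (hf' : HasDerivAt f' f2 x) (h0 : f x ≠ 0) :
    HasDerivAt (fun p => 2 * s * (s * p + r) / f p - (s * p + r) ^ 2 * f' p / f p ^ 2)
      (2 * (s * f x - (s * x + r) * f' x) ^ 2 / f x ^ 3 - (s * x + r) ^ 2 * f2 / f x ^ 2) x := by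
  have h := (((hasDerivAt_affine s r x).const_mul (2 * s)).div hf h0).sub
    ((((hasDerivAt_affine s r x).pow 2).mul hf').div (hf.pow 2) (pow_ne_zero 2 h0))
  refine h.congr_deriv ?_
  simp only [Pi.pow_apply, Pi.mul_apply]
  field_simp
  norm_num
  ring

/-- Second derivative of the reduced functional, written after expanding the square. -/
theorem deriv_deriv_reduced_pos {a A B α β c k K N s r : ℝ} (ha : 0 < a) (hc : 0 < c)
    (hK : 0 < K) (hN : 0 < N) (hs : s ≠ 0) {f F : ℝ → ℝ}
    (hf : ∀ p, f p = A + B * p - a * p ^ 2)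
    (hF : ∀ p, 0 < f p → F p = α * p + β - c * Real.log (f p) + k * f p
      + K * ((s * p + r) ^ 2 / f p) + N * ((1 * p + 0) ^ 2 / f p))
    {p : ℝ} (hp : 0 < f p) (hk : k * f p ≤ c) :
    DifferentiableAt ℝ F p ∧ 0 < deriv (deriv F) p := by
  have hfd : ∀ x, HasDerivAt f (B - 2 * a * x) x := fun x => by
    rw [funext hf]; exact hasDerivAt_quadratic a A B x
  have hfd' : HasDerivAt (fun x => B - 2 * a * x) (-(2 * a)) p :=
    (((hasDerivAt_id' p).const_mul (2 * a)).const_sub B).congr_deriv (by ring)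
  have hcont : Continuous f := continuous_iff_continuousAt.2 fun x => (hfd x).continuousAt
  have hopen : IsOpen {x | 0 < f x} := isOpen_lt continuous_const hcont
  have hF1 : ∀ x, 0 < f x → HasDerivAt F (α - c * ((B - 2 * a * x) / f x)
      + k * (B - 2 * a * x)
      + K * (2 * s * (s * x + r) / f x - (s * x + r) ^ 2 * (B - 2 * a * x) / f x ^ 2)
      + N * (2 * 1 * (1 * x + 0) / f x - (1 * x + 0) ^ 2 * (B - 2 * a * x) / f x ^ 2)) x := by
    intro x hx
    have h := ((((hasDerivAt_affine α β x).sub (((hfd x).log hx.ne').const_mul c)).add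
      ((hfd x).const_mul k)).add ((hasDerivAt_affine_sq_div (f' := fun x => B - 2 * a * x)
        (s := s) (r := r) (hfd x) hx.ne').const_mul K)).add
      ((hasDerivAt_affine_sq_div (f' := fun x => B - 2 * a * x)
        (s := 1) (r := 0) (hfd x) hx.ne').const_mul N)
    refine h.congr_of_eventuallyEq ?_
    filter_upwards [hopen.mem_nhds hx] with y hy
    exact hF y hy
  have hF2 := (((((hfd'.div (hfd p) hp.ne').const_mul c).const_sub α).add
      (hfd'.const_mul k)).add ((hasDerivAt_deriv_affine_sq_div
        (s := s) (r := r) (hfd p) hfd' hp.ne').const_mul K)).add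
      ((hasDerivAt_deriv_affine_sq_div
        (s := 1) (r := 0) (hfd p) hfd' hp.ne').const_mul N)
  refine ⟨(hF1 p hp).differentiableAt, ?_⟩
  have hev : deriv F =ᶠ[nhds p] _ :=
    Filter.eventually_of_mem (hopen.mem_nhds hp) fun x hx => (hF1 x hx).deriv
  rw [(hF2.congr_of_eventuallyEq hev).deriv]
  set w := f p
  set d := B - 2 * a * p
  have h1 : 0 ≤ -(c * ((-(2 * a) * w - d * d) / w ^ 2)) + k * -(2 * a) := by
    have : -(c * ((-(2 * a) * w - d * d) / w ^ 2)) + k * -(2 * a)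
        = (2 * a * w * (c - k * w) + c * d ^ 2) / w ^ 2 := by
      field_simp
      ring
    rw [this]
    have : 0 ≤ c - k * w := by linarith
    positivity
  have h2 : ∀ s r : ℝ, s ≠ 0 →
      0 < 2 * (s * w - (s * p + r) * d) ^ 2 / w ^ 3 - (s * p + r) ^ 2 * -(2 * a) / w ^ 2 := by
    intro s r hs
    have : 2 * (s * w - (s * p + r) * d) ^ 2 / w ^ 3 - (s * p + r) ^ 2 * -(2 * a) / w ^ 2
        = 2 * (s * w - (s * p + r) * d) ^ 2 / w ^ 3 + 2 * a * (s * p + r) ^ 2 / w ^ 2 := by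
      ring
    rw [this]
    by_cases hg : s * p + r = 0
    · have : s * w - (s * p + r) * d ≠ 0 := by
        rw [hg, zero_mul, sub_zero]
        exact mul_ne_zero hs hp.ne'
      positivity
    · positivity
  have h3 := mul_pos hK (h2 s r hs)
  have h4 := mul_pos hN (h2 1 0 one_ne_zero)
  linarith

theorem convex_setOf_quadratic_pos {a A B : ℝ} (ha : 0 < a) {f : ℝ → ℝ}
    (hf : ∀ p, f p = A + B * p - a * p ^ 2) : Convex ℝ {p | 0 < f p} := by
  intro x hx y hy t u ht hu htu
  simp only [Set.mem_ofPred_eq, smul_eq_mul] at *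
  have h : f (t * x + u * y) = t * f x + u * f y + a * (t * u) * (x - y) ^ 2 := by
    obtain rfl : u = 1 - t := by linarith
    simp only [hf]
    ring
  have h' : 0 < t * f x + u * f y := by
    simpa using (convex_Ioi (0 : ℝ)) hx hy ht hu htu
  rw [h]
  positivity

theorem abs_le_of_quadratic_pos {a A B p : ℝ} (ha : 0 < a) (hA : 0 < A)
    (hp : 0 < A + B * p - a * p ^ 2) : |p| ≤ (A + |B|) / a + 1 := by
  by_contra! h
  have h0 : 0 ≤ (A + |B|) / a := by positivity
  have h1 : 1 < |p| := by linarith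
  have h2 : A + |B| < a * |p| := by
    have : (A + |B|) / a < |p| := by linarith
    rw [div_lt_iff₀ ha] at this
    linarith
  have h3 : B * p ≤ |B| * |p| := by
    rw [← abs_mul]
    exact le_abs_self _
  have h4 : a * p ^ 2 = (a * |p|) * |p| := by
    rw [← sq_abs p]
    ring
  nlinarith [mul_lt_mul_of_pos_right h2 (by linarith : 0 < |p|)]

/-- A function dominated from below by a logarithmic barrier attains its minimum. -/
theorem exists_isMinOn_of_log_barrier {a A B α β c : ℝ} (ha : 0 < a) (hA : 0 < A)
    (hα : 0 < α) (hc : 0 < c) {f F : ℝ → ℝ} (hf : ∀ p, f p = A + B * p - a * p ^ 2)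
    (hcont : ContinuousOn F {p | 0 < f p})
    (hlow : ∀ p, 0 < f p → α * p + β - c * Real.log (f p) ≤ F p) :
    ∃ p, 0 < f p ∧ IsMinOn F {p | 0 < f p} p := by
  set R := (A + |B|) / a + 1
  have hR : ∀ p, 0 < f p → |p| ≤ R := fun p hp =>
    abs_le_of_quadratic_pos ha hA (by rw [← hf]; exact hp)
  have hfc : Continuous f := by
    rw [funext hf]
    fun_prop
  set ε := min A (Real.exp (-((F 0 - β + α * R) / c)))
  have hε : 0 < ε := lt_min hA (Real.exp_pos _)
  have hf0 : f 0 = A := by rw [hf]; ring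
  have hcomp : IsCompact {p | ε ≤ f p} := by
    refine (isCompact_Icc (a := -R) (b := R)).of_isClosed_subset
      (isClosed_le continuous_const hfc) fun p hp => ?_
    exact abs_le.1 (hR p (hε.trans_le hp))
  have h0 : (0 : ℝ) ∈ {p | ε ≤ f p} := by
    rw [Set.mem_ofPred_eq, hf0]
    exact min_le_left _ _
  obtain ⟨p, hp, hmin⟩ := hcomp.exists_isMinOn ⟨0, h0⟩
    (hcont.mono fun x (hx : ε ≤ f x) => hε.trans_le hx)
  refine ⟨p, hε.trans_le hp, fun x (hx : 0 < f x) => ?_⟩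
  rcases le_or_gt ε (f x) with h | h
  · exact hmin h
  · have hp0 : F p ≤ F 0 := hmin h0
    have h1 : Real.log (f x) ≤ -((F 0 - β + α * R) / c) := by
      rw [Real.log_le_iff_le_exp hx]
      exact h.le.trans (min_le_right _ _)
    have h2 : c * Real.log (f x) ≤ -(F 0 - β + α * R) := by
      calc c * Real.log (f x) ≤ c * -((F 0 - β + α * R) / c) := by gcongr
        _ = _ := by field_simp
    have h3 : α * -R ≤ α * x := by
      gcongr
      exact (abs_le.1 (hR x hx)).1
    have := hlow x hx
    change F p ≤ F x
    linarith

/-- **Strict convexity of the reduced functional and uniqueness of minimizers for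
small time steps.** If `max f ≤ 2νc/(τλ²)`, then `F'' > 0` on `{f > 0}`, `F` is
strictly convex there, the minimization of `F` over `{f > 0}` has at most one
solution, and the incremental minimization problem for `G(τ,(q₀,p₀,θ₀);·)` has a
unique minimizer. -/
theorem stmt9 (m ν κ lam c : ℝ) (hm : 0 < m) (hν : 0 < ν) (hκ : 0 < κ)
    (hlam : 0 < lam) (hc : 0 < c) (τ q0 p0 θ0 : ℝ) (hτ : 0 < τ) (hθ0 : 0 < θ0)
    (f F : ℝ → ℝ)
    (hf : ∀ p, f p = θ0 - τ ^ 2 * κ / (m ^ 2 * c) * p ^ 2 - τ * κ / (m * c) * p * q0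
      - p ^ 2 / (m * c) + p * p0 / (m * c))
    (hF : ∀ p, F p = τ * lam / m * p - c * Real.log (f p)
      + τ / (2 * ν * f p) * ((p - p0) / τ + τ * κ / m * p + κ * q0 + lam * f p) ^ 2
      + τ * ν / (2 * m) * p ^ 2 / f p + c * Real.log θ0)
    (hsmall : ∀ p, f p ≤ 2 * ν * c / (τ * lam ^ 2)) :
    (∀ p, 0 < f p → 0 < deriv (deriv F) p) ∧
    StrictConvexOn ℝ {p | 0 < f p} F ∧
    (∀ p1 p2, 0 < f p1 → 0 < f p2 →
      IsMinOn F {p | 0 < f p} p1 → IsMinOn F {p | 0 < f p} p2 → p1 = p2) ∧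
    (∃! y : ℝ × ℝ × ℝ,
      ∀ z : ℝ × ℝ × ℝ, Ginc m ν κ lam c τ (q0, p0, θ0) y ≤ Ginc m ν κ lam c τ (q0, p0, θ0) z) := by
  have hfq : ∀ p, f p = θ0 + (p0 / (m * c) - τ * κ / (m * c) * q0) * p
      - (τ ^ 2 * κ / (m ^ 2 * c) + 1 / (m * c)) * p ^ 2 := fun p => by rw [hf]; ring
  have ha : 0 < τ ^ 2 * κ / (m ^ 2 * c) + 1 / (m * c) := by positivity
  have hs : 1 / τ + τ * κ / m ≠ 0 := by positivity
  have hFq : ∀ p, 0 < f p → F p = (τ * lam / m + τ * lam / ν * (1 / τ + τ * κ / m)) * p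
      + (c * Real.log θ0 + τ * lam / ν * (κ * q0 - p0 / τ))
      - c * Real.log (f p) + τ * lam ^ 2 / (2 * ν) * f p
      + τ / (2 * ν) * (((1 / τ + τ * κ / m) * p + (κ * q0 - p0 / τ)) ^ 2 / f p)
      + τ * ν / (2 * m) * ((1 * p + 0) ^ 2 / f p) := by
    intro p hp
    rw [hF]
    generalize Real.log (f p) = L
    generalize f p = w at hp
    field_simp
    ring
  have hD : ∀ p, 0 < f p → DifferentiableAt ℝ F p ∧ 0 < deriv (deriv F) p := fun p hp => by
    refine deriv_deriv_reduced_pos ha hc (by positivity) (by positivity) hs hfq hFq hp ?_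
    calc τ * lam ^ 2 / (2 * ν) * f p
        ≤ τ * lam ^ 2 / (2 * ν) * (2 * ν * c / (τ * lam ^ 2)) := by
          gcongr
          exact hsmall p
      _ = c := by field_simp
  have hcont : ContinuousOn F {p | 0 < f p} := fun p hp =>
    (hD p hp).1.continuousAt.continuousWithinAt
  have hconv : StrictConvexOn ℝ {p | 0 < f p} F :=
    strictConvexOn_of_deriv2_pos' (convex_setOf_quadratic_pos ha hfq) hcont
      fun p hp => (hD p hp).2
  have huniq : ∀ p1 p2, 0 < f p1 → 0 < f p2 →
      IsMinOn F {p | 0 < f p} p1 → IsMinOn F {p | 0 < f p} p2 → p1 = p2 :=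
    fun p1 p2 h1 h2 hm1 hm2 => hconv.eq_of_isMinOn hm1 hm2 h1 h2
  refine ⟨fun p hp => (hD p hp).2, hconv, huniq, ?_⟩
  obtain ⟨p, hp, hmin⟩ := exists_isMinOn_of_log_barrier (α := τ * lam / m)
    (β := c * Real.log θ0) ha hθ0 (by positivity) hc hfq hcont fun x hx => by
      rw [hF]
      have h1 : 0 ≤ τ / (2 * ν * f x)
          * ((x - p0) / τ + τ * κ / m * x + κ * q0 + lam * f x) ^ 2 := by positivity
      have h2 : 0 ≤ τ * ν / (2 * m) * x ^ 2 / f x := by positivity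
      linarith
  have hG : ∀ x, 0 < f x →
      Ginc m ν κ lam c τ (q0, p0, θ0) (q0 + τ * x / m, x, f x) = (F x : EReal) := by
    intro x hx
    have h1 : (q0 + τ * x / m - q0) / τ = x / m := by field_simp; ring
    have h2 : c * (f x - θ0) / τ
        = -(x / m) * ((x - p0) / τ) - κ * x * (q0 + τ * x / m) / m := by
      rw [hf]
      field_simp
      ring
    rw [Ginc, if_pos ⟨hx, h1, h2⟩, hF]
    congr 1
    have h3 : (x - p0) / τ + κ * (q0 + τ * x / m) + lam * f x
        = (x - p0) / τ + τ * κ / m * x + κ * q0 + lam * f x := by ring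
    simp only [h3]
    ring
  have hG' : ∀ y : ℝ × ℝ × ℝ, Ginc m ν κ lam c τ (q0, p0, θ0) y ≠ ⊤ →
      0 < f y.2.1 ∧ y = (q0 + τ * y.2.1 / m, y.2.1, f y.2.1) := by
    rintro ⟨q, x, θ⟩ hy
    rw [Ginc] at hy
    split_ifs at hy with h
    · obtain ⟨hθ, h1, h2⟩ := h
      simp only at hθ h1 h2 ⊢
      have hq : q = q0 + τ * x / m := by
        field_simp at h1 ⊢
        linarith
      have hθf : θ = f x := by
        rw [hq] at h2
        have h4 : θ = θ0 + τ / c *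
            (-(x / m) * ((x - p0) / τ) - κ * x * (q0 + τ * x / m) / m) := by
          rw [← h2]
          field_simp
          ring
        rw [h4, hf]
        field_simp
        ring
      rw [← hθf, ← hq]
      exact ⟨hθ, rfl⟩
    · exact absurd rfl hy
  refine ⟨(q0 + τ * p / m, p, f p), fun z => ?_, fun y hy => ?_⟩
  · by_cases hz : Ginc m ν κ lam c τ (q0, p0, θ0) z = ⊤
    · rw [hz]
      exact le_top
    · obtain ⟨hz1, hz2⟩ := hG' z hz
      rw [hz2, hG p hp, hG _ hz1]
      exact EReal.coe_le_coe_iff.2 (hmin hz1)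
  · have hyt : Ginc m ν κ lam c τ (q0, p0, θ0) y ≠ ⊤ := fun h => by
      have := hy (q0 + τ * p / m, p, f p)
      rw [h, hG p hp] at this
      exact EReal.coe_ne_top _ (top_le_iff.1 this)
    obtain ⟨hy1, hy2⟩ := hG' y hyt
    have hymin : IsMinOn F {p | 0 < f p} y.2.1 := fun x (hx : 0 < f x) => by
      have := hy (q0 + τ * x / m, x, f x)
      rw [hy2, hG x hx, hG _ hy1] at this
      exact EReal.coe_le_coe_iff.1 this
    rw [hy2, huniq y.2.1 p hy1 hp hymin hmin]
end

section
/- For every τ > 0 and every (q₀, p₀, θ₀) ∈ ℝ × ℝ × (0,∞), the implicit Euler scheme for the damped harmonic oscillator admits a unique solution with positive temperature: there exists exactly one (q, p, θ) ∈ ℝ × ℝ × (0,∞) such that (q − q₀)/τ = p/m, (p − p₀)/τ = −νp/m − κq − λθ, and (θ − θ₀)/τ = νp²/(m²c) + λpθ/(mc). -/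
/-- A quadratic `a t² + b t - e` with `a, e > 0` has exactly one positive root. -/
lemma existsUnique_pos_root_quadratic {a b e : ℝ} (ha : 0 < a) (he : 0 < e) :
    ∃! t : ℝ, 0 < t ∧ a * t ^ 2 + b * t - e = 0 := by
  have hD : b ^ 2 < b ^ 2 + 4 * a * e := by nlinarith [mul_pos ha he]
  have hb : b < √(b ^ 2 + 4 * a * e) := Real.lt_sqrt_of_sq_lt hD
  have hsq := Real.sq_sqrt ((sq_nonneg b).trans hD.le)
  refine ⟨(√(b ^ 2 + 4 * a * e) - b) / (2 * a), ⟨div_pos (by linarith) (by linarith), ?_⟩, ?_⟩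
  · generalize √(b ^ 2 + 4 * a * e) = s at hsq ⊢
    field_simp
    linear_combination hsq
  · rintro t ⟨ht, h⟩
    have hpos : 0 < 2 * a * t + b := by
      refine pos_of_mul_pos_right (a := t) ?_ ht.le
      nlinarith [mul_pos ha (pow_pos ht 2)]
    have hroot : √(b ^ 2 + 4 * a * e) = 2 * a * t + b := by
      rw [← Real.sqrt_sq hpos.le]
      congr 1
      linear_combination (-4 * a) * h
    rw [hroot]
    field_simp
    ring

/-- The implicit Euler equations determine `p` and `q` as affine functions of `θ`, and reduce to a
single quadratic equation for `θ`. -/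
lemma implicitEuler_iff {m ν κ lam c τ A B : ℝ} (q0 p0 θ0 : ℝ) (hm : 0 < m) (hc : 0 < c)
    (hτ : 0 < τ) (hA : 0 < A) (hA_def : A = m + τ * ν + τ ^ 2 * κ) (hB : B = p0 - τ * κ * q0)
    (q p θ : ℝ) :
    ((q - q0) / τ = p / m ∧ (p - p0) / τ = -ν * p / m - κ * q - lam * θ ∧
      (θ - θ0) / τ = ν * p ^ 2 / (m ^ 2 * c) + lam * p * θ / (m * c)) ↔
    q = q0 + τ * ((B - τ * lam * θ) / A) ∧ p = m * ((B - τ * lam * θ) / A) ∧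
      ((τ * lam) ^ 2 * (A - τ * ν)) * θ ^ 2 +
        (c * A ^ 2 + 2 * τ * ν * (τ * lam) * B - τ * lam * A * B) * θ -
        (c * A ^ 2 * θ0 + τ * ν * B ^ 2) = 0 := by
  obtain ⟨x, rfl⟩ : ∃ x, p = m * x := ⟨p / m, by field_simp⟩
  have h1 : (q - q0) / τ = m * x / m ↔ q = q0 + τ * x := by
    field_simp
    constructor <;> intro h <;> linear_combination h
  have h2 : (m * x - p0) / τ = -ν * (m * x) / m - κ * (q0 + τ * x) - lam * θ ↔
      x = (B - τ * lam * θ) / A := by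
    rw [eq_div_iff hA.ne']
    field_simp
    subst hA_def hB
    constructor <;> intro h <;> linear_combination h
  have h3 : (θ - θ0) / τ = ν * (m * x) ^ 2 / (m ^ 2 * c) + lam * (m * x) * θ / (m * c) ↔
      c * (θ - θ0) - τ * ν * x ^ 2 - τ * lam * x * θ = 0 := by
    field_simp
    constructor <;> intro h <;> linear_combination h
  have h4 : x = (B - τ * lam * θ) / A →
      (c * (θ - θ0) - τ * ν * x ^ 2 - τ * lam * x * θ = 0 ↔
      ((τ * lam) ^ 2 * (A - τ * ν)) * θ ^ 2 +
        (c * A ^ 2 + 2 * τ * ν * (τ * lam) * B - τ * lam * A * B) * θ -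
        (c * A ^ 2 * θ0 + τ * ν * B ^ 2) = 0) := by
    intro hx
    rw [eq_div_iff hA.ne'] at hx
    obtain rfl : B = x * A + τ * lam * θ := by linear_combination -hx
    rw [← mul_eq_zero_iff_left (pow_pos hA 2).ne']
    constructor <;> intro h <;> linear_combination h
  rw [h1, h3, mul_right_inj' hm.ne']
  constructor
  · rintro ⟨rfl, hx, h⟩
    rw [h2] at hx
    exact ⟨by rw [← hx], hx, (h4 hx).1 h⟩
  · rintro ⟨hq, hx, h⟩
    rw [← hx] at hq
    subst hq
    exact ⟨rfl, h2.2 hx, (h4 hx).2 h⟩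

/-- **Unique solvability of the implicit Euler scheme for the damped harmonic
oscillator.** For every time step `τ > 0` and every datum `(q₀,p₀,θ₀)` with
`θ₀ > 0`, there is exactly one `(q,p,θ)` with `θ > 0` satisfying
`(q − q₀)/τ = p/m`, `(p − p₀)/τ = −νp/m − κq − λθ`, and
`(θ − θ₀)/τ = νp²/(m²c) + λpθ/(mc)`. -/
theorem stmt11 (m ν κ lam c : ℝ) (hm : 0 < m) (hν : 0 < ν) (hκ : 0 < κ)
    (hlam : 0 < lam) (hc : 0 < c) (τ q0 p0 θ0 : ℝ) (hτ : 0 < τ) (hθ0 : 0 < θ0) :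
    ∃! y : ℝ × ℝ × ℝ, 0 < y.2.2 ∧
      (y.1 - q0) / τ = y.2.1 / m ∧
      (y.2.1 - p0) / τ = -ν * y.2.1 / m - κ * y.1 - lam * y.2.2 ∧
      (y.2.2 - θ0) / τ = ν * y.2.1 ^ 2 / (m ^ 2 * c) + lam * y.2.1 * y.2.2 / (m * c) := by
  have hA : 0 < m + τ * ν + τ ^ 2 * κ := by positivity
  have ha : 0 < (τ * lam) ^ 2 * (m + τ * ν + τ ^ 2 * κ - τ * ν) := by
    have : 0 < m + τ ^ 2 * κ := by positivity
    exact mul_pos (by positivity) (by linarith)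
  obtain ⟨θ, ⟨hθ, hroot⟩, huniq⟩ := existsUnique_pos_root_quadratic
    (b := c * (m + τ * ν + τ ^ 2 * κ) ^ 2 + 2 * τ * ν * (τ * lam) * (p0 - τ * κ * q0) -
      τ * lam * (m + τ * ν + τ ^ 2 * κ) * (p0 - τ * κ * q0)) ha
    (show 0 < c * (m + τ * ν + τ ^ 2 * κ) ^ 2 * θ0 + τ * ν * (p0 - τ * κ * q0) ^ 2 by positivity)
  have key := implicitEuler_iff (lam := lam) q0 p0 θ0 hm hc hτ hA rfl rfl
  refine ⟨(_, _, θ), ⟨hθ, (key _ _ θ).2 ⟨rfl, rfl, hroot⟩⟩, ?_⟩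
  rintro ⟨q, p, θ'⟩ ⟨hθ', h⟩
  obtain ⟨hq, hp, hroot'⟩ := (key q p θ').1 h
  obtain rfl := huniq θ' ⟨hθ', hroot'⟩
  rw [hq, hp]
end

section
/- Let (q_i, p_i, θ_i), i = 0, …, N, with θ_i > 0 satisfy the scheme constraints (q_i − q_{i−1})/τ_i = p_i/m and c(θ_i − θ_{i−1})/τ_i = −κ q_i p_i/m − (p_i/m)(p_i − p_{i−1})/τ_i for i = 1, …, N. Then for each step the exact discrete energy identity E(y_i) + (κ/2)|q_i − q_{i−1}|² + (1/(2m))|p_i − p_{i−1}|² = E(y_{i−1}) holds, where y_i = (q_i,p_i,θ_i); consequently, for every j = 1, …, N, E(y_j) + ∑_{i=1}^{j} (κ/2)|q_i − q_{i−1}|² + ∑_{i=1}^{j} (1/(2m))|p_i − p_{i−1}|² = E(y₀). In particular E(y_j) is nonincreasing in j, with equality E(y_i) = E(y_{i−1}) if and only if q_i = q_{i−1} and p_i = p_{i−1}. -/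
/-- Total energy of the damped harmonic oscillator. -/
noncomputable def En (m κ c q p θ : ℝ) : ℝ := p ^ 2 / (2 * m) + c * θ + κ * q ^ 2 / 2

/-- One step of the scheme dissipates exactly the squared increments of `q` and `p`. -/
theorem En_add_increments_eq {m κ c τ q q' p p' θ θ' : ℝ} (hm : m ≠ 0) (hτ : τ ≠ 0)
    (hq : (q - q') / τ = p / m)
    (hθ : c * (θ - θ') / τ = -κ * q * p / m - (p / m) * ((p - p') / τ)) :
    En m κ c q p θ + κ / 2 * (q - q') ^ 2 + 1 / (2 * m) * (p - p') ^ 2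
      = En m κ c q' p' θ' := by
  have h : c * (θ - θ') = -κ * q * (q - q') - p / m * (p - p') := by
    have hq' : q - q' = τ * (p / m) := by rw [← hq]; field_simp
    rw [hq', ← div_mul_cancel₀ (c * (θ - θ')) hτ, hθ]
    field_simp
  unfold En
  field_simp at h ⊢
  linear_combination 2 * h

/-- **Exact discrete energy identity for the minimizing-movements scheme.**
If `(qᵢ,pᵢ,θᵢ)` satisfy the scheme constraints, then at each step
`E(yᵢ) + (κ/2)|qᵢ−qᵢ₋₁|² + (1/2m)|pᵢ−pᵢ₋₁|² = E(yᵢ₋₁)`; summing,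
`E(y_j) + Σ (κ/2)|Δq|² + Σ (1/2m)|Δp|² = E(y₀)`; in particular the discrete
energy is nonincreasing, with equality iff `qᵢ = qᵢ₋₁` and `pᵢ = pᵢ₋₁`. -/
theorem stmt13 (m ν κ lam c : ℝ) (hm : 0 < m) (hν : 0 < ν) (hκ : 0 < κ)
    (hlam : 0 < lam) (hc : 0 < c) (N : ℕ) (τ q p θ : ℕ → ℝ)
    (hτ : ∀ i, 1 ≤ i → i ≤ N → 0 < τ i)
    (hθpos : ∀ i, i ≤ N → 0 < θ i)
    (hc1 : ∀ i, 1 ≤ i → i ≤ N → (q i - q (i - 1)) / τ i = p i / m)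
    (hc2 : ∀ i, 1 ≤ i → i ≤ N →
      c * (θ i - θ (i - 1)) / τ i
        = -κ * q i * p i / m - (p i / m) * ((p i - p (i - 1)) / τ i)) :
    (∀ i, 1 ≤ i → i ≤ N →
      En m κ c (q i) (p i) (θ i) + κ / 2 * (q i - q (i - 1)) ^ 2
        + 1 / (2 * m) * (p i - p (i - 1)) ^ 2
        = En m κ c (q (i - 1)) (p (i - 1)) (θ (i - 1))) ∧
    (∀ j, 1 ≤ j → j ≤ N →
      En m κ c (q j) (p j) (θ j)
        + ∑ i ∈ Finset.Icc 1 j, κ / 2 * (q i - q (i - 1)) ^ 2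
        + ∑ i ∈ Finset.Icc 1 j, 1 / (2 * m) * (p i - p (i - 1)) ^ 2
        = En m κ c (q 0) (p 0) (θ 0)) ∧
    (∀ i, 1 ≤ i → i ≤ N →
      En m κ c (q i) (p i) (θ i) ≤ En m κ c (q (i - 1)) (p (i - 1)) (θ (i - 1)) ∧
      (En m κ c (q i) (p i) (θ i) = En m κ c (q (i - 1)) (p (i - 1)) (θ (i - 1)) ↔
        q i = q (i - 1) ∧ p i = p (i - 1))) := by
  have step : ∀ i, 1 ≤ i → i ≤ N →
      En m κ c (q i) (p i) (θ i) + κ / 2 * (q i - q (i - 1)) ^ 2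
        + 1 / (2 * m) * (p i - p (i - 1)) ^ 2
        = En m κ c (q (i - 1)) (p (i - 1)) (θ (i - 1)) := fun i h1 hN =>
    En_add_increments_eq hm.ne' (hτ i h1 hN).ne' (hc1 i h1 hN) (hc2 i h1 hN)
  refine ⟨step, fun j hj => ?_, fun i h1 hN => ?_⟩
  · induction j, hj using Nat.le_induction with
    | base => intro hN; simpa using step 1 le_rfl hN
    | succ k hk ih =>
      intro hN
      have hs := step (k + 1) (by lia) hN
      rw [Finset.sum_Icc_succ_top (by lia), Finset.sum_Icc_succ_top (by lia)]
      rw [Nat.add_sub_cancel] at hs ⊢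
      linarith [ih (by lia)]
  · have hs := step i h1 hN
    have hq : 0 ≤ κ / 2 * (q i - q (i - 1)) ^ 2 := by positivity
    have hp : 0 ≤ 1 / (2 * m) * (p i - p (i - 1)) ^ 2 := by positivity
    refine ⟨by linarith, fun h => ?_, fun ⟨h, h'⟩ => ?_⟩
    · have hq0 : κ / 2 * (q i - q (i - 1)) ^ 2 = 0 := by linarith
      have hp0 : 1 / (2 * m) * (p i - p (i - 1)) ^ 2 = 0 := by linarith
      simpa [hκ.ne', hm.ne', sub_eq_zero] using And.intro hq0 hp0
    · simpa [h, h'] using hs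
end

section
/- Let (q_i, p_i, θ_i), i = 0, …, N, with θ_i > 0 satisfy the scheme constraints (q_i − q_{i−1})/τ_i = p_i/m and c(θ_i − θ_{i−1})/τ_i = −κ q_i p_i/m − (p_i/m)(p_i − p_{i−1})/τ_i for i = 1, …, N. Then for every i: p_i²/(2m) + cθ_i + κq_i²/2 ≤ E(q₀,p₀,θ₀); in particular |p_i| ≤ (2m E(y₀))^{1/2}, θ_i ≤ E(y₀)/c, |q_i| ≤ (2E(y₀)/κ)^{1/2}, and the difference quotients satisfy |(q_i − q_{i−1})/τ_i| = |p_i|/m ≤ (2E(y₀)/m)^{1/2}, all bounds depending only on the initial datum and the material parameters and not on the time partition. -/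
/-- One step of the implicit scheme dissipates the total energy. -/
theorem En_le_of_step {m κ c t q q' p p' θ θ' : ℝ} (hm : 0 < m) (hκ : 0 < κ) (ht : 0 < t)
    (h1 : (q - q') / t = p / m)
    (h2 : c * (θ - θ') / t = -κ * q * p / m - (p / m) * ((p - p') / t)) :
    En m κ c q p θ ≤ En m κ c q' p' θ' := by
  have hθ : c * (θ - θ') = -κ * q * (q - q') - p / m * (p - p') := by
    have h3 : c * (θ - θ') / t = (-κ * q * (q - q') - p / m * (p - p')) / t := by
      rw [h2, mul_div_assoc (-κ * q), ← h1]
      ring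
    exact (div_left_inj' ht.ne').mp h3
  have hdiss : En m κ c q' p' θ' - En m κ c q p θ
      = (p - p') ^ 2 / (2 * m) + κ * (q - q') ^ 2 / 2 := by
    unfold En
    linear_combination -hθ
  have : 0 ≤ (p - p') ^ 2 / (2 * m) + κ * (q - q') ^ 2 / 2 := by positivity
  linarith

/-- **Uniform a priori bounds for the discrete solutions.** If `(qᵢ,pᵢ,θᵢ)` satisfy
the scheme constraints, then for every `i ≤ N`:
`pᵢ²/(2m) + cθᵢ + κqᵢ²/2 ≤ E(y₀)`, hence `|pᵢ| ≤ (2mE(y₀))^½`, `θᵢ ≤ E(y₀)/c`,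
`|qᵢ| ≤ (2E(y₀)/κ)^½`, and `|(qᵢ−qᵢ₋₁)/τᵢ| = |pᵢ|/m ≤ (2E(y₀)/m)^½`;
all bounds depend only on the initial datum and the material parameters. -/
theorem stmt14 (m ν κ lam c : ℝ) (hm : 0 < m) (hν : 0 < ν) (hκ : 0 < κ)
    (hlam : 0 < lam) (hc : 0 < c) (N : ℕ) (τ q p θ : ℕ → ℝ)
    (hτ : ∀ i, 1 ≤ i → i ≤ N → 0 < τ i)
    (hθpos : ∀ i, i ≤ N → 0 < θ i)
    (hc1 : ∀ i, 1 ≤ i → i ≤ N → (q i - q (i - 1)) / τ i = p i / m)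
    (hc2 : ∀ i, 1 ≤ i → i ≤ N →
      c * (θ i - θ (i - 1)) / τ i
        = -κ * q i * p i / m - (p i / m) * ((p i - p (i - 1)) / τ i)) :
    (∀ i, i ≤ N →
      p i ^ 2 / (2 * m) + c * θ i + κ * q i ^ 2 / 2 ≤ En m κ c (q 0) (p 0) (θ 0) ∧
      |p i| ≤ Real.sqrt (2 * m * En m κ c (q 0) (p 0) (θ 0)) ∧
      θ i ≤ En m κ c (q 0) (p 0) (θ 0) / c ∧
      |q i| ≤ Real.sqrt (2 * En m κ c (q 0) (p 0) (θ 0) / κ)) ∧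
    (∀ i, 1 ≤ i → i ≤ N →
      |(q i - q (i - 1)) / τ i| = |p i| / m ∧
      |p i| / m ≤ Real.sqrt (2 * En m κ c (q 0) (p 0) (θ 0) / m)) := by
  have hE : ∀ i, i ≤ N → En m κ c (q i) (p i) (θ i) ≤ En m κ c (q 0) (p 0) (θ 0) := by
    intro i
    induction i with
    | zero => exact fun _ => le_rfl
    | succ k ih =>
      intro hk
      have hk1 : 1 ≤ k + 1 := Nat.le_add_left 1 k
      exact (En_le_of_step hm hκ (hτ _ hk1 hk) (hc1 _ hk1 hk) (hc2 _ hk1 hk)).trans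
        (ih (Nat.le_of_succ_le hk))
  generalize En m κ c (q 0) (p 0) (θ 0) = E at hE ⊢
  unfold En at hE
  have hkin : ∀ i, i ≤ N → p i ^ 2 ≤ 2 * m * E := by
    intro i hi
    have hcθ := mul_pos hc (hθpos i hi)
    have hq : 0 ≤ κ * q i ^ 2 / 2 := by positivity
    have hp : p i ^ 2 / (2 * m) ≤ E := by linarith [hE i hi]
    rwa [div_le_iff₀' (by positivity)] at hp
  refine ⟨fun i hi => ⟨hE i hi, Real.abs_le_sqrt (hkin i hi), ?_, Real.abs_le_sqrt ?_⟩,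
    fun i h1 hi => ⟨?_, ?_⟩⟩
  · have hq : 0 ≤ κ * q i ^ 2 / 2 := by positivity
    have hp : 0 ≤ p i ^ 2 / (2 * m) := by positivity
    rw [le_div_iff₀' hc]
    linarith [hE i hi]
  · have hcθ := mul_pos hc (hθpos i hi)
    have hp : 0 ≤ p i ^ 2 / (2 * m) := by positivity
    rw [le_div_iff₀' hκ]
    linarith [hE i hi]
  · rw [hc1 i h1 hi, abs_div, abs_of_pos hm]
  · apply Real.le_sqrt_of_sq_le
    rw [div_pow, sq_abs, div_le_div_iff₀ (by positivity) hm]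
    nlinarith [mul_le_mul_of_nonneg_right (hkin i hi) hm.le]
end

section
/- Let (q_i, p_i, θ_i), i = 0, …, N, with θ_i > 0 satisfy the scheme constraints and G(τ_i, y_{i−1}; y_i) ≤ 0 for all i = 1, …, N, where y_i = (q_i,p_i,θ_i). Then the discrete entropy is nondecreasing, S(y_{i−1}) ≤ S(y_i) for all i, and there exists θ_min > 0 depending only on the initial datum y₀ = (q₀,p₀,θ₀) and the material parameters (but not on the time partition) such that θ_i ≥ θ_min for all i = 1, …, N. -/
/-- Total entropy of the damped harmonic oscillator. -/
noncomputable def Sent (lam c q θ : ℝ) : ℝ := -lam * q + c + c * Real.log θ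

/-- Total energy of the damped harmonic oscillator. -/
noncomputable def Etot (m κ c q p θ : ℝ) : ℝ := p ^ 2 / (2 * m) + c * θ + κ * q ^ 2 / 2

/-- One step of the scheme with nonpositive incremental functional keeps the temperature
positive, does not decrease the entropy, and does not increase the energy. -/
lemma step_of_Ginc_nonpos {m ν κ lam c τ q p θ q' p' θ' : ℝ} (hm : 0 < m) (hν : 0 < ν)
    (hκ : 0 < κ) (hτ : 0 < τ) (h : Ginc m ν κ lam c τ (q, p, θ) (q', p', θ') ≤ 0) :
    0 < θ' ∧ Sent lam c q θ ≤ Sent lam c q' θ' ∧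
      Etot m κ c q' p' θ' ≤ Etot m κ c q p θ := by
  unfold Ginc at h
  split_ifs at h with hcon
  · obtain ⟨hθ, hq, he⟩ := hcon
    dsimp only at h hθ hq he
    have hG := EReal.coe_nonpos.mp h
    refine ⟨hθ, ?_, ?_⟩
    · have h1 : 0 ≤ τ / (2 * ν * θ') * ((p' - p) / τ + κ * q' + lam * θ') ^ 2 := by positivity
      have h2 : 0 ≤ τ * ν / (2 * m) * p' ^ 2 / θ' := by positivity
      unfold Sent
      linarith
    · have hq' : q' - q = τ * (p' / m) := by
        rw [← hq]; field_simp
      have he' : c * (θ' - θ) = -(p' / m) * (p' - p) - κ * q' * (q' - q) := by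
        rw [hq']
        field_simp at he ⊢
        linarith
      have h3 : Etot m κ c q p θ - Etot m κ c q' p' θ'
          = (p' - p) ^ 2 / (2 * m) + κ * (q' - q) ^ 2 / 2 := by
        have h4 : Etot m κ c q p θ - Etot m κ c q' p' θ'
            = p ^ 2 / (2 * m) - p' ^ 2 / (2 * m) - c * (θ' - θ)
              + κ * q ^ 2 / 2 - κ * q' ^ 2 / 2 := by
          unfold Etot; ring
        rw [h4, he']
        field_simp
        ring
      have h5 : 0 ≤ (p' - p) ^ 2 / (2 * m) + κ * (q' - q) ^ 2 / 2 := by positivity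
      linarith
  · simp at h

/-- Entropy and energy along a discrete trajectory, compared with their initial values. -/
lemma entropy_energy_bounds {m ν κ lam c : ℝ} (hm : 0 < m) (hν : 0 < ν) (hκ : 0 < κ)
    {N : ℕ} {τ q p θ : ℕ → ℝ} (hτ : ∀ i, 1 ≤ i → i ≤ N → 0 < τ i)
    (hG : ∀ i, 1 ≤ i → i ≤ N →
      Ginc m ν κ lam c (τ i) (q (i - 1), p (i - 1), θ (i - 1)) (q i, p i, θ i) ≤ 0)
    {i : ℕ} (hi : i ≤ N) :
    Sent lam c (q 0) (θ 0) ≤ Sent lam c (q i) (θ i) ∧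
      Etot m κ c (q i) (p i) (θ i) ≤ Etot m κ c (q 0) (p 0) (θ 0) := by
  induction i with
  | zero => exact ⟨le_rfl, le_rfl⟩
  | succ k ih =>
    obtain ⟨hS, hE⟩ := ih (by omega)
    have h := hG (k + 1) (by omega) hi
    rw [Nat.add_sub_cancel] at h
    obtain ⟨-, hS', hE'⟩ := step_of_Ginc_nonpos hm hν hκ (hτ (k + 1) (by omega) hi) h
    exact ⟨hS.trans hS', hE'.trans hE⟩

/-- **Discrete entropy monotonicity and uniform lower temperature bound.** Along any
discrete trajectory satisfying the scheme constraints (with `θᵢ > 0`) and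
`G(τᵢ,yᵢ₋₁;yᵢ) ≤ 0`, the entropy `S(yᵢ)` is nondecreasing; moreover there is
`θ_min > 0`, depending only on the initial datum `(q⁰,p⁰,θ⁰)` and the material
parameters — and not on the time partition — with `θᵢ ≥ θ_min` for all `i`. -/
theorem stmt15 (m ν κ lam c : ℝ) (hm : 0 < m) (hν : 0 < ν) (hκ : 0 < κ)
    (hlam : 0 < lam) (hc : 0 < c) (q0 p0 θ0 : ℝ) (hθ0 : 0 < θ0) :
    (∀ (N : ℕ) (τ q p θ : ℕ → ℝ),
      q 0 = q0 → p 0 = p0 → θ 0 = θ0 →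
      (∀ i, 1 ≤ i → i ≤ N → 0 < τ i) →
      (∀ i, 1 ≤ i → i ≤ N →
        Ginc m ν κ lam c (τ i) (q (i - 1), p (i - 1), θ (i - 1)) (q i, p i, θ i) ≤ 0) →
      ∀ i, 1 ≤ i → i ≤ N →
        Sent lam c (q (i - 1)) (θ (i - 1)) ≤ Sent lam c (q i) (θ i)) ∧
    (∃ θmin : ℝ, 0 < θmin ∧
      ∀ (N : ℕ) (τ q p θ : ℕ → ℝ),
        q 0 = q0 → p 0 = p0 → θ 0 = θ0 →
        (∀ i, 1 ≤ i → i ≤ N → 0 < τ i) →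
        (∀ i, 1 ≤ i → i ≤ N →
          Ginc m ν κ lam c (τ i) (q (i - 1), p (i - 1), θ (i - 1)) (q i, p i, θ i) ≤ 0) →
        ∀ i, 1 ≤ i → i ≤ N → θmin ≤ θ i) := by
  refine ⟨fun N τ q p θ _ _ _ hτ hG i h1 hN =>
    (step_of_Ginc_nonpos hm hν hκ (hτ i h1 hN) (hG i h1 hN)).2.1,
    Real.exp ((Sent lam c q0 θ0 - c - lam * (2 * Etot m κ c q0 p0 θ0 / κ + 1)) / c),
    Real.exp_pos _, ?_⟩
  rintro N τ q p θ rfl rfl rfl hτ hG i h1 hN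
  obtain ⟨hθ, -, -⟩ := step_of_Ginc_nonpos hm hν hκ (hτ i h1 hN) (hG i h1 hN)
  obtain ⟨hS, hE⟩ := entropy_energy_bounds hm hν hκ hτ hG hN
  rw [← Real.le_log_iff_exp_le hθ, div_le_iff₀ hc]
  have hq : q i ^ 2 ≤ 2 * Etot m κ c (q 0) (p 0) (θ 0) / κ := by
    rw [le_div_iff₀ hκ]
    have hp : 0 ≤ p i ^ 2 / (2 * m) := by positivity
    have hcθ : 0 < c * θ i := by positivity
    unfold Etot at hE ⊢
    linarith
  have hq' : lam * -(q i) ≤ lam * (2 * Etot m κ c (q 0) (p 0) (θ 0) / κ + 1) :=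
    mul_le_mul_of_nonneg_left (by nlinarith [sq_nonneg (q i + 1)]) hlam.le
  have hS' : Sent lam c (q i) (θ i) = -lam * q i + c + c * Real.log (θ i) := rfl
  linarith
end

section
/- Let φ : ℝ^d → ℝ^d be a C¹ diffeomorphism, E, S : ℝ^d → ℝ continuously differentiable, and L, K : ℝ^d → Matrix (Fin d) (Fin d) ℝ with L(y) antisymmetric and K(y) symmetric positive semidefinite for all y, satisfying the noninteraction condition L(y)ᵀ∇S(y) = 0 and K(y)∇E(y) = 0. Define Ẽ = E ∘ φ, S̃ = S ∘ φ, L̃(ỹ) = Dφ(ỹ)⁻¹ L(φ(ỹ)) (Dφ(ỹ)⁻¹)ᵀ and K̃(ỹ) = Dφ(ỹ)⁻¹ K(φ(ỹ)) (Dφ(ỹ)⁻¹)ᵀ. Then: (i) L̃(ỹ) is antisymmetric and K̃(ỹ) is symmetric positive semidefinite for all ỹ, and the noninteraction condition L̃(ỹ)ᵀ∇S̃(ỹ) = 0, K̃(ỹ)∇Ẽ(ỹ) = 0 holds; (ii) a differentiable curve ỹ : [0,T] → ℝ^d solves ỹ' = L̃(ỹ)∇Ẽ(ỹ) + K̃(ỹ)∇S̃(ỹ)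 if and only if y = φ ∘ ỹ solves y' = L(y)∇E(y) + K(y)∇S(y). -/
open Matrix

/-- The gradient of a scalar function on `ℝ^d`, via partial derivatives. -/
noncomputable def gradv {d : ℕ} (f : (Fin d → ℝ) → ℝ) (y : Fin d → ℝ) : Fin d → ℝ :=
  fun i => fderiv ℝ f y (Pi.single i 1)

/-- The Jacobian matrix of a map `φ : ℝ^d → ℝ^d`. -/
noncomputable def jacMat {d : ℕ} (φ : (Fin d → ℝ) → Fin d → ℝ) (y : Fin d → ℝ) :
    Matrix (Fin d) (Fin d) ℝ :=
  Matrix.of fun i j => fderiv ℝ φ y (Pi.single j 1) i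

/-- The transformed operator `Ã(ỹ) = Dφ(ỹ)⁻¹ A(φ(ỹ)) (Dφ(ỹ)⁻¹)ᵀ`. -/
noncomputable def tildeMat {d : ℕ} (φ : (Fin d → ℝ) → Fin d → ℝ)
    (A : (Fin d → ℝ) → Matrix (Fin d) (Fin d) ℝ) (y : Fin d → ℝ) :
    Matrix (Fin d) (Fin d) ℝ :=
  (jacMat φ y)⁻¹ * A (φ y) * ((jacMat φ y)⁻¹)ᵀ

theorem jacMat_mulVec {d : ℕ} (φ : (Fin d → ℝ) → Fin d → ℝ) (y v : Fin d → ℝ) :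
    jacMat φ y *ᵥ v = fderiv ℝ φ y v := by
  have h : jacMat φ y = LinearMap.toMatrix' (fderiv ℝ φ y : (Fin d → ℝ) →ₗ[ℝ] Fin d → ℝ) := by
    ext i j
    simp [jacMat, LinearMap.toMatrix'_apply]
  rw [h, LinearMap.toMatrix'_mulVec]
  rfl

theorem gradv_dotProduct {d : ℕ} (f : (Fin d → ℝ) → ℝ) (y v : Fin d → ℝ) :
    gradv f y ⬝ᵥ v = fderiv ℝ f y v := by
  conv_rhs => rw [pi_eq_sum_univ' v, map_sum]
  simp [gradv, dotProduct, mul_comm, Pi.single]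

theorem gradv_comp {d : ℕ} {φ : (Fin d → ℝ) → Fin d → ℝ} {f : (Fin d → ℝ) → ℝ}
    {y : Fin d → ℝ} (hf : DifferentiableAt ℝ f (φ y)) (hφ : DifferentiableAt ℝ φ y) :
    gradv (f ∘ φ) y = (jacMat φ y)ᵀ *ᵥ gradv f (φ y) := by
  ext i
  rw [gradv, fderiv_comp y hf hφ, ContinuousLinearMap.comp_apply, ← gradv_dotProduct,
    dotProduct_comm]
  rfl

theorem isUnit_det_jacMat {d : ℕ} {φ ψ : (Fin d → ℝ) → Fin d → ℝ} {y : Fin d → ℝ}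
    (hφ : DifferentiableAt ℝ φ y) (hψ : DifferentiableAt ℝ ψ (φ y))
    (hinv : Function.LeftInverse ψ φ) : IsUnit (jacMat φ y).det := by
  have h : jacMat ψ (φ y) * jacMat φ y = 1 := by
    refine Matrix.ext_of_mulVec_single fun i => ?_
    rw [← mulVec_mulVec, jacMat_mulVec, jacMat_mulVec, ← ContinuousLinearMap.comp_apply,
      ← fderiv_comp y hψ hφ, hinv.comp_eq_id, fderiv_id, one_mulVec]
    rfl
  exact isUnit_det_of_left_inverse h

theorem tildeMat_transpose {d : ℕ} (φ : (Fin d → ℝ) → Fin d → ℝ)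
    (A : (Fin d → ℝ) → Matrix (Fin d) (Fin d) ℝ) (y : Fin d → ℝ) :
    (tildeMat φ A y)ᵀ = tildeMat φ (fun z => (A z)ᵀ) y := by
  simp only [tildeMat, transpose_mul, transpose_transpose, Matrix.mul_assoc]

theorem tildeMat_mulVec_gradv_comp {d : ℕ} {φ : (Fin d → ℝ) → Fin d → ℝ}
    {f : (Fin d → ℝ) → ℝ} {y : Fin d → ℝ} (A : (Fin d → ℝ) → Matrix (Fin d) (Fin d) ℝ)
    (hf : DifferentiableAt ℝ f (φ y)) (hφ : DifferentiableAt ℝ φ y)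
    (hJ : IsUnit (jacMat φ y).det) :
    tildeMat φ A y *ᵥ gradv (f ∘ φ) y = (jacMat φ y)⁻¹ *ᵥ (A (φ y) *ᵥ gradv f (φ y)) := by
  rw [gradv_comp hf hφ, tildeMat, mulVec_mulVec, Matrix.mul_assoc, ← transpose_mul,
    mul_nonsing_inv _ hJ, transpose_one, Matrix.mul_one, mulVec_mulVec]

/-- **Invariance of the GENERIC structure under coordinate changes.** Let `φ` be a
`C¹` diffeomorphism of `ℝ^d` (with `C¹` inverse `ψ`), `E, S` be `C¹`, `L(y)`
antisymmetric, `K(y)` symmetric positive semidefinite, with the noninteraction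
condition. Then the transformed quintuple `(Ẽ, S̃, L̃, K̃)` enjoys the same
structural properties, and a differentiable curve `ỹ` solves the transformed
GENERIC system on `[0,T]` iff `y = φ ∘ ỹ` solves the original one. -/
theorem stmt19 {d : ℕ} (T : ℝ) (hT : 0 < T)
    (φ ψ : (Fin d → ℝ) → Fin d → ℝ)
    (hφ : ContDiff ℝ 1 φ) (hψ : ContDiff ℝ 1 ψ)
    (hinv1 : Function.LeftInverse ψ φ) (hinv2 : Function.RightInverse ψ φ)
    (E S : (Fin d → ℝ) → ℝ) (hE : ContDiff ℝ 1 E) (hS : ContDiff ℝ 1 S)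
    (L K : (Fin d → ℝ) → Matrix (Fin d) (Fin d) ℝ)
    (hLanti : ∀ y, (L y)ᵀ = -L y)
    (hKpsd : ∀ y, (K y).PosSemidef)
    (hNI1 : ∀ y, (L y)ᵀ.mulVec (gradv S y) = 0)
    (hNI2 : ∀ y, (K y).mulVec (gradv E y) = 0) :
    ((∀ y, (tildeMat φ L y)ᵀ = -tildeMat φ L y) ∧
     (∀ y, (tildeMat φ K y).PosSemidef) ∧
     (∀ y, (tildeMat φ L y)ᵀ.mulVec (gradv (S ∘ φ) y) = 0) ∧
     (∀ y, (tildeMat φ K y).mulVec (gradv (E ∘ φ) y) = 0)) ∧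
    (∀ ytil : ℝ → Fin d → ℝ, Differentiable ℝ ytil →
      ((∀ t ∈ Set.Icc (0 : ℝ) T,
          deriv ytil t
            = (tildeMat φ L (ytil t)).mulVec (gradv (E ∘ φ) (ytil t))
              + (tildeMat φ K (ytil t)).mulVec (gradv (S ∘ φ) (ytil t))) ↔
       (∀ t ∈ Set.Icc (0 : ℝ) T,
          deriv (fun s => φ (ytil s)) t
            = (L (φ (ytil t))).mulVec (gradv E (φ (ytil t)))
              + (K (φ (ytil t))).mulVec (gradv S (φ (ytil t)))))) := by
  have dφ : Differentiable ℝ φ := hφ.differentiable one_ne_zero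
  have dψ : Differentiable ℝ ψ := hψ.differentiable one_ne_zero
  have dE : Differentiable ℝ E := hE.differentiable one_ne_zero
  have dS : Differentiable ℝ S := hS.differentiable one_ne_zero
  have hJ : ∀ y, IsUnit (jacMat φ y).det := fun y => isUnit_det_jacMat (dφ y) (dψ _) hinv1
  refine ⟨⟨fun y => ?_, fun y => ?_, fun y => ?_, fun y => ?_⟩, fun ytil hy => ?_⟩
  · rw [tildeMat_transpose]
    simp only [tildeMat, hLanti, Matrix.mul_neg, Matrix.neg_mul]
  · have h := (hKpsd (φ y)).mul_mul_conjTranspose_same (jacMat φ y)⁻¹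
    rwa [conjTranspose_eq_transpose_of_trivial] at h
  · rw [tildeMat_transpose, tildeMat_mulVec_gradv_comp _ (dS _) (dφ y) (hJ y), hNI1,
      mulVec_zero]
  · rw [tildeMat_mulVec_gradv_comp _ (dE _) (dφ y) (hJ y), hNI2, mulVec_zero]
  · refine forall₂_congr fun t _ => ?_
    have hderiv : deriv (fun s => φ (ytil s)) t = jacMat φ (ytil t) *ᵥ deriv ytil t := by
      rw [jacMat_mulVec]
      exact ((dφ (ytil t)).hasFDerivAt.comp_hasDerivAt t (hy t).hasDerivAt).deriv
    rw [hderiv, tildeMat_mulVec_gradv_comp _ (dE _) (dφ _) (hJ _),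
      tildeMat_mulVec_gradv_comp _ (dS _) (dφ _) (hJ _), ← mulVec_add]
    constructor
    · intro h
      rw [h, mulVec_mulVec, mul_nonsing_inv _ (hJ _), one_mulVec]
    · intro h
      rw [← h, mulVec_mulVec, nonsing_inv_mul _ (hJ _), one_mulVec]
end
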